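/- Let A and B be simple unital complex C*-algebras, φ : GL(A) → GL(B) a group isomorphism, and θ the induced map on idempotents. Suppose e, f, g ∈ Ĩ(A) are pairwise orthogonal nontrivial idempotents with e + f + g ≠ 1 which are pairwise ∼_c-equivalent. If θ(x)θ(y) = 0 for some two distinct x, y ∈ {e, f, g}, then θ(x)θ(y) = 0 for all distinct x, y ∈ {e, f, g}; likewise, if θ(1 − x)θ(1 − y) = 0 for some two distinct x, y ∈ {e, f, g}, then θ(1 − x)θ(1 − y) = 0 for all distinct x, y ∈ {e, f, g}. -/

import Mathlib

noncomputable section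

/-- The symmetry `1 - 2e` associated to an idempotent `e` is a unit (its own inverse). -/
def symUnit {A : Type*} [Ring A] {e : A} (he : IsIdempotentElem e) : Aˣ where
  val := 1 - 2 * e
  inv := 1 - 2 * e
  val_inv := by
    have h : e * e = e := he
    have expand : (1 - 2 * e) * (1 - 2 * e) = 1 - 4 * e + 4 * (e * e) := by noncomm_ring
    rw [expand, h]; noncomm_ring
  inv_val := by
    have h : e * e = e := he
    have expand : (1 - 2 * e) * (1 - 2 * e) = 1 - 4 * e + 4 * (e * e) := by noncomm_ring
    rw [expand, h]; noncomm_ring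

/-- The map `θ_φ` induced on idempotents by a map `φ` between the groups of invertible
elements, determined by `1 - 2 θ_φ(e) = φ(1 - 2e)`, i.e. `θ_φ(e) = (1 - φ(1 - 2e))/2`;
it is extended by `0` off the set of idempotents. -/
noncomputable def theta {A B : Type*} [Ring A] [Ring B] [Algebra ℂ B]
    (φ : Aˣ → Bˣ) (e : A) : B :=
  letI := Classical.propDecidable (IsIdempotentElem e)
  if h : IsIdempotentElem e then (2 : ℂ)⁻¹ • ((1 : B) - (φ (symUnit h) : B)) else 0

/-- `a` and `b` are coefficient maps for the idempotent `e` (w.r.t. `φ`):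
`φ(λe + 1 - e) = a(λ) θ(e) + b(λ) θ(1-e)` for all nonzero `λ`. -/
def IsCoeffMaps {A B : Type*} [Ring A] [Ring B] [Algebra ℂ A] [Algebra ℂ B]
    (φ : Aˣ → Bˣ) (e : A) (a b : ℂˣ →* ℂˣ) : Prop :=
  ∀ (lam : ℂˣ) (v : Aˣ), (v : A) = (lam : ℂ) • e + 1 - e →
    (φ v : B) = ((a lam : ℂˣ) : ℂ) • theta φ e + ((b lam : ℂˣ) : ℂ) • theta φ (1 - e)

/-- `c(λ) = a(λ) b(λ)⁻¹`, as an element of `ℂˣ`. -/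
def cOf (a b : ℂˣ →* ℂˣ) (lam : ℂˣ) : ℂˣ := a lam * (b lam)⁻¹

/-- `e ∼_c f`: the functions `c_e` and `c_f` agree (for some, equivalently any,
choice of coefficient maps). -/
def cEquiv {A B : Type*} [Ring A] [Ring B] [Algebra ℂ A] [Algebra ℂ B]
    (φ : Aˣ → Bˣ) (e f : A) : Prop :=
  ∃ ae be af bf : ℂˣ →* ℂˣ, IsCoeffMaps φ e ae be ∧ IsCoeffMaps φ f af bf ∧
    ∀ lam : ℂˣ, cOf ae be lam = cOf af bf lam

variable {A B : Type*}
  [NormedRing A] [StarRing A] [CStarRing A] [CompleteSpace A]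
  [NormedAlgebra ℂ A] [StarModule ℂ A]
  [NormedRing B] [StarRing B] [CStarRing B] [CompleteSpace B]
  [NormedAlgebra ℂ B] [StarModule ℂ B]


/-- A simple ring is prime. -/
lemma IsSimpleRing.eq_zero_or_eq_zero_of_forall_mul_mul {R : Type*} [Ring R] [IsSimpleRing R]
    {p q : R} (h : ∀ x, p * x * q = 0) : p = 0 ∨ q = 0 := by
  let I : TwoSidedIdeal R := .mk' {y | ∀ x, y * x * q = 0}
    (by simp) (fun hx hy z => by rw [add_mul, add_mul, hx z, hy z, add_zero])
    (fun hx z => by rw [neg_mul, neg_mul, hx z, neg_zero])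
    (fun {x y} hy z => by rw [mul_assoc, mul_assoc, ← mul_assoc y, hy z, mul_zero])
    (fun {x y} hx z => by rw [mul_assoc x, hx (y * z)])
  by_cases hp : p = 0
  · exact .inl hp
  · have h1 : (1 : R) ∈ I :=
      IsSimpleRing.one_mem_of_ne_zero_mem I hp ((TwoSidedIdeal.mem_mk' _ _ _ _ _ _ p).2 h)
    have h2 := (TwoSidedIdeal.mem_mk' _ _ _ _ _ _ (1 : R)).1 h1 1
    exact .inr (by simpa using h2)

/-- The unit `1 + n` for an element `n` of square zero. -/
def unitOneAdd {R : Type*} [Ring R] (n : R) (hn : n * n = 0) : Rˣ where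
  val := 1 + n
  inv := 1 - n
  val_inv := by
    have : (1 + n) * (1 - n) = 1 - n * n := by noncomm_ring
    rw [this, hn, sub_zero]
  inv_val := by
    have : (1 - n) * (1 + n) = 1 - n * n := by noncomm_ring
    rw [this, hn, sub_zero]

/-- If `z` acts on `p` from the left and on `q` from the right by distinct scalars and commutes
with the units `1 + p x q`, then `p` or `q` vanishes. -/
lemma eq_zero_or_eq_zero_of_commute_units {R : Type*} [Ring R] [Algebra ℂ R] [IsSimpleRing R]
    {p q z : R} {α β : ℂ} (hqp : q * p = 0) (hzp : z * p = α • p) (hqz : q * z = β • q)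
    (hαβ : α ≠ β)
    (hcomm : ∀ (w : Rˣ) (x : R), (w : R) = 1 + p * x * q → z * w = w * z) : p = 0 ∨ q = 0 := by
  refine IsSimpleRing.eq_zero_or_eq_zero_of_forall_mul_mul fun x => ?_
  have hn : p * x * q * (p * x * q) = 0 := by
    rw [show p * x * q * (p * x * q) = p * x * (q * p) * x * q by noncomm_ring, hqp]
    simp
  have h := hcomm (unitOneAdd _ hn) x rfl
  simp only [unitOneAdd, mul_add, add_mul, mul_one, one_mul, add_right_inj] at h
  rw [← mul_assoc, ← mul_assoc, hzp, mul_assoc _ q z, hqz, smul_mul_assoc, smul_mul_assoc,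
    mul_smul_comm, ← sub_eq_zero, ← sub_smul] at h
  exact (smul_eq_zero.1 h).resolve_left (sub_ne_zero.2 hαβ)

section Theta

variable {R S : Type*} [Ring R] [Ring S]

lemma symUnit_mul_self {e : R} (he : IsIdempotentElem e) : symUnit he * symUnit he = 1 :=
  Units.ext (symUnit he).val_inv

variable [Algebra ℂ S]

lemma apply_symUnit (φ : Rˣ → Sˣ) {e : R} (he : IsIdempotentElem e) :
    (φ (symUnit he) : S) = 1 - (2 : ℂ) • theta φ e := by
  rw [theta, dif_pos he, smul_smul]
  norm_num

lemma theta_eq (φ : Rˣ → Sˣ) {e : R} (he : IsIdempotentElem e) :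
    theta φ e = (2 : ℂ)⁻¹ • ((1 : S) - (φ (symUnit he) : S)) := by
  rw [theta, dif_pos he]

lemma theta_idempotent (φ : Rˣ ≃* Sˣ) {e : R} (he : IsIdempotentElem e) :
    IsIdempotentElem (theta φ e) := by
  have h : (φ (symUnit he) : S) * φ (symUnit he) = 1 := by
    rw [← Units.val_mul, ← map_mul, symUnit_mul_self, map_one, Units.val_one]
  rw [IsIdempotentElem, theta_eq _ he, smul_mul_smul_comm, sub_mul, mul_sub, mul_sub, h]
  simp only [one_mul, mul_one]
  module

lemma theta_commute (φ : Rˣ ≃* Sˣ) {e f : R} (he : IsIdempotentElem e) (hf : IsIdempotentElem f)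
    (hef : e * f = f * e) : theta φ e * theta φ f = theta φ f * theta φ e := by
  have h : symUnit he * symUnit hf = symUnit hf * symUnit he := by
    ext
    have h1 : (1 - 2 * e) * (1 - 2 * f) = 1 - 2 * e - 2 * f + 4 * (e * f) := by noncomm_ring
    have h2 : (1 - 2 * f) * (1 - 2 * e) = 1 - 2 * e - 2 * f + 4 * (f * e) := by noncomm_ring
    change (1 - 2 * e) * (1 - 2 * f) = (1 - 2 * f) * (1 - 2 * e)
    rw [h1, h2, hef]
  have h' : (φ (symUnit he) : S) * φ (symUnit hf) = φ (symUnit hf) * φ (symUnit he) := by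
    rw [← Units.val_mul, ← Units.val_mul, ← map_mul, ← map_mul, h]
  rw [theta_eq _ he, theta_eq _ hf, smul_mul_smul_comm, smul_mul_smul_comm]
  congr 1
  simp only [mul_sub, sub_mul, one_mul, mul_one, h']
  abel

variable [Algebra ℂ R]

/-- A group isomorphism onto the units of a simple algebra sends `-1` to `-1`. -/
lemma map_neg_one_of_isSimpleRing [IsSimpleRing R] [IsSimpleRing S] (φ : Rˣ ≃* Sˣ) :
    φ (-1) = -1 := by
  have h : (φ (-1) : S) * φ (-1) = 1 := by
    rw [← Units.val_mul, ← map_mul]; simp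
  obtain ⟨z, hz⟩ : ∃ z : S, z = φ (-1) := ⟨_, rfl⟩
  rw [← hz] at h
  have key : (1 - z) = 0 ∨ (1 + z) = 0 := by
    refine eq_zero_or_eq_zero_of_commute_units (z := z) (α := -1) (β := 1) ?_ ?_ ?_ (by norm_num) ?_
    · simp [mul_sub, add_mul, h, add_comm]
    · simp [mul_sub, h]
    · simp [add_mul, h, add_comm]
    · intro w x _
      rw [hz, ← Units.val_mul, ← Units.val_mul]
      congr 1
      obtain ⟨v, rfl⟩ := φ.surjective w
      rw [← map_mul, ← map_mul]
      simp
  rcases key with h1 | h1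
  · exfalso
    have h2 : φ (-1) = φ 1 := by
      ext
      rw [← hz, map_one, Units.val_one]
      exact (sub_eq_zero.1 h1).symm
    have h3 : (-1 : R) = 1 := by simpa using congrArg Units.val (φ.injective h2)
    have h4 : (2 : ℂ) • (1 : R) = 0 := by
      rw [two_smul]; nth_rewrite 1 [← h3]; simp
    exact (smul_eq_zero.1 h4).elim (by norm_num) one_ne_zero
  · ext
    rw [← hz]
    simpa using eq_neg_of_add_eq_zero_right h1

lemma theta_ne_zero (φ : Rˣ ≃* Sˣ) {e : R} (he : IsIdempotentElem e) (he0 : e ≠ 0) :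
    theta φ e ≠ 0 := by
  intro h
  have h1 : φ (symUnit he) = φ 1 := by
    ext; rw [apply_symUnit, h]; simp
  have h2 : 1 - 2 * e = 1 := congrArg Units.val (φ.injective h1)
  have h3 : (2 : ℂ) • e = 0 := by
    rw [two_smul, ← two_mul]; simpa using h2
  exact he0 ((smul_eq_zero.1 h3).resolve_left (by norm_num))

lemma theta_one_sub [IsSimpleRing R] [IsSimpleRing S] (φ : Rˣ ≃* Sˣ) {e : R}
    (he : IsIdempotentElem e) : theta φ (1 - e) = 1 - theta φ e := by
  have h : symUnit he.one_sub = -1 * symUnit he := by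
    ext
    change 1 - 2 * (1 - e) = -1 * (1 - 2 * e)
    noncomm_ring
  rw [theta_eq _ he, theta_eq _ he.one_sub, h, map_mul, map_neg_one_of_isSimpleRing]
  simp only [neg_mul, one_mul, Units.val_neg]
  module

lemma theta_ne_one [IsSimpleRing R] [IsSimpleRing S] (φ : Rˣ ≃* Sˣ) {e : R}
    (he : IsIdempotentElem e) (he1 : e ≠ 1) : theta φ e ≠ 1 := by
  intro h
  refine theta_ne_zero φ he.one_sub (sub_ne_zero.2 he1.symm) ?_
  rw [theta_one_sub φ he, h, sub_self]

lemma scale_mul_scale {e : R} (he : IsIdempotentElem e) {x y : ℂ} (h : x * y = 1) :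
    (x • e + 1 - e) * (y • e + 1 - e) = 1 := by
  have hxy : (x • e + 1 - e) * (y • e + 1 - e) = (x * y) • e + 1 - e := by
    simp only [add_mul, sub_mul, mul_add, mul_sub, one_mul, mul_one, smul_mul_assoc,
      mul_smul_comm, he.eq]
    module
  rw [hxy, h, one_smul, add_sub_cancel_left]

/-- The unit `λ e + (1 - e)`. -/
def scaleUnit {e : R} (he : IsIdempotentElem e) (lam : ℂˣ) : Rˣ where
  val := (lam : ℂ) • e + 1 - e
  inv := ((lam⁻¹ : ℂˣ) : ℂ) • e + 1 - e
  val_inv := scale_mul_scale he lam.mul_inv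
  inv_val := scale_mul_scale he lam.inv_mul

lemma IsCoeffMaps.apply_ne [IsSimpleRing R] [IsSimpleRing S] (φ : Rˣ ≃* Sˣ) {e : R}
    (he : IsIdempotentElem e) (he0 : e ≠ 0) (he1 : e ≠ 1) {a b : ℂˣ →* ℂˣ}
    (h : IsCoeffMaps φ e a b) {lam : ℂˣ} (hlam : lam ≠ 1) : a lam ≠ b lam := by
  intro hab
  have hv := h lam (scaleUnit he lam) rfl
  rw [hab, ← smul_add, theta_one_sub φ he, add_sub_cancel] at hv
  have hlam' : (lam : ℂ) ≠ 1 := fun H => hlam (Units.ext H)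
  have key : e = 0 ∨ 1 - e = 0 := by
    refine eq_zero_or_eq_zero_of_commute_units (z := (scaleUnit he lam : R)) (α := lam) (β := 1)
      ?_ ?_ ?_ hlam' ?_
    · rw [sub_mul, he.eq]; simp
    · simp [scaleUnit, add_mul, sub_mul, he.eq]
    · simp [scaleUnit, mul_add, sub_mul, mul_sub, he.eq]
    · intro w x _
      rw [← Units.val_mul, ← Units.val_mul]
      congr 1
      apply φ.injective
      ext
      rw [map_mul, map_mul, Units.val_mul, Units.val_mul, hv]
      simp
  exact key.elim he0 fun H => he1 (sub_eq_zero.1 H).symm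

/-- For orthogonal `e ∼_c f`, the images are orthogonal or co-orthogonal. -/
lemma theta_mul_eq_zero_or [IsSimpleRing R] [IsSimpleRing S] (φ : Rˣ ≃* Sˣ) {e f : R}
    (he : IsIdempotentElem e) (he0 : e ≠ 0) (he1 : e ≠ 1) (hf : IsIdempotentElem f)
    (hef : e * f = 0) (hfe : f * e = 0) (hc : cEquiv φ e f) :
    theta φ e * theta φ f = 0 ∨ (1 - theta φ e) * (1 - theta φ f) = 0 := by
  obtain ⟨a, b, a', b', hab, hab', hcc⟩ := hc
  set P := theta φ e with hP
  set Q := theta φ f with hQ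
  have hPP : P * P = P := theta_idempotent φ he
  have hQQ : Q * Q = Q := theta_idempotent φ hf
  have hPQ : P * Q = Q * P := theta_commute φ he hf (hef.trans hfe.symm)
  let two : ℂˣ := Units.mk0 2 two_ne_zero
  have hu : (φ (scaleUnit he two) : S) = (a two : ℂ) • P + (b two : ℂ) • (1 - P) := by
    rw [hab two _ rfl, theta_one_sub φ he]
  have hv : (φ (scaleUnit hf two) : S) = (a' two : ℂ) • Q + (b' two : ℂ) • (1 - Q) := by
    rw [hab' two _ rfl, theta_one_sub φ hf]
  have hne : (a two : ℂ) * a' two ≠ b two * b' two := by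
    intro H
    have H' : a two * a' two = b two * b' two := Units.ext H
    have h1 := hcc two
    simp only [cOf] at h1
    have h2 : a two * b' two = a' two * b two := by
      rw [← div_eq_mul_inv, ← div_eq_mul_inv, div_eq_div_iff_mul_eq_mul] at h1
      exact h1
    have h4 : two * two ≠ 1 := by
      intro H2
      have H3 := congrArg Units.val H2
      norm_num [two] at H3
    refine hab.apply_ne φ he he0 he1 h4 ?_
    rw [map_mul, map_mul]
    have h5 : a two * a two * b' two = b two * b two * b' two := by
      rw [mul_assoc, h2, ← mul_assoc, H', mul_assoc, mul_assoc, mul_comm (b' two)]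
    exact mul_right_cancel h5
  have hse := apply_symUnit φ he
  have hsf := apply_symUnit φ hf
  rw [← hP] at hse
  rw [← hQ] at hsf
  have hPPQ : P * (P * Q) = P * Q := by rw [← mul_assoc, hPP]
  have hQPQ : Q * (P * Q) = P * Q := by rw [hPQ, ← mul_assoc, hQQ]
  have hFP : (1 - P) * (1 - Q) * P = 0 := by
    rw [show (1 - P) * (1 - Q) * P = P - P * P - (Q * P) + P * (Q * P) by noncomm_ring, ← hPQ,
      hPPQ, hPP]
    abel
  have hFQ : (1 - P) * (1 - Q) * Q = 0 := by
    rw [mul_assoc, sub_mul 1 Q Q, hQQ]; simp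
  refine eq_zero_or_eq_zero_of_commute_units
    (z := (φ (scaleUnit he two * scaleUnit hf two) : S)) ?_ ?_ ?_ hne ?_
  · rw [← mul_assoc, hFP, zero_mul]
  · rw [map_mul, Units.val_mul, hu, hv, mul_assoc]
    simp only [add_mul, sub_mul, smul_mul_assoc, one_mul, mul_smul_comm, hPPQ, hQPQ,
      sub_self, smul_zero, add_zero, smul_smul]
    rw [mul_comm]
  · rw [map_mul, Units.val_mul, hu, hv, ← mul_assoc]
    generalize (1 - P) * (1 - Q) = F at hFP hFQ
    simp only [mul_add, mul_sub, mul_smul_comm, hFP, hFQ, mul_one, smul_mul_assoc, sub_zero,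
      smul_zero, zero_add, smul_smul]
    rw [mul_comm]
  · intro w x hw
    obtain ⟨v, rfl⟩ := φ.surjective w
    rw [← Units.val_mul, ← Units.val_mul, ← map_mul, ← map_mul]
    congr 2
    have hs : v * (symUnit he * symUnit hf) = symUnit he * symUnit hf * v := by
      apply φ.injective
      ext
      simp only [map_mul, Units.val_mul, hse, hsf, hw]
      have e1 : (1 - (2 : ℂ) • P) * (1 - (2 : ℂ) • Q) * (P * Q) = P * Q := by
        rw [mul_assoc]
        simp only [sub_mul, smul_mul_assoc, one_mul, mul_smul_comm, mul_sub, hPPQ, hQPQ]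
        module
      have e2 : (1 - P) * (1 - Q) * ((1 - (2 : ℂ) • P) * (1 - (2 : ℂ) • Q)) =
          (1 - P) * (1 - Q) := by
        rw [← mul_assoc, mul_sub _ 1 ((2 : ℂ) • P), mul_smul_comm, hFP, mul_one, smul_zero,
          sub_zero, mul_sub, mul_smul_comm, hFQ, mul_one, smul_zero, sub_zero]
      rw [add_mul, mul_add, one_mul, mul_one, mul_assoc (P * Q * x), e2]
      simp only [← mul_assoc] at e1 ⊢
      rw [e1]
    have hs' : (v : R) * (e + f) = (e + f) * v := by
      have h1 := congrArg Units.val hs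
      have h2 : ((symUnit he * symUnit hf : Rˣ) : R) = 1 - (2 : ℂ) • (e + f) := by
        change (1 - 2 * e) * (1 - 2 * f) = _
        rw [show (1 - 2 * e) * (1 - 2 * f) = 1 - 2 * (e + f) + 4 * (e * f) by noncomm_ring, hef,
          two_smul, two_mul]
        simp
      rw [Units.val_mul, Units.val_mul _ v, h2, mul_sub, sub_mul, mul_one, one_mul,
        sub_right_inj, mul_smul_comm, smul_mul_assoc] at h1
      exact smul_right_injective R (two_ne_zero (α := ℂ)) h1
    ext
    have h3 : ((scaleUnit he two * scaleUnit hf two : Rˣ) : R) = 1 + (e + f) := by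
      change ((2 : ℂ) • e + 1 - e) * ((2 : ℂ) • f + 1 - f) = _
      rw [two_smul, two_smul, show (e + e + 1 - e) * (f + f + 1 - f) = 1 + (e + f) + e * f by
        noncomm_ring, hef, add_zero]
    rw [Units.val_mul, Units.val_mul v, h3, add_mul, mul_add, hs', one_mul, mul_one]

end Theta

/-- For nontrivial idempotents that are pairwise orthogonal or co-orthogonal, orthogonality spreads
from one pair to another. -/
lemma mul_eq_zero_of_orthogonal_or {R : Type*} [Ring R] {P Q T : R} (hQ0 : Q ≠ 0) (hT1 : T ≠ 1)
    (hPQ : P * Q = Q * P)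
    (hPT' : P * T = 0 ∨ (1 - P) * (1 - T) = 0) (hQT' : Q * T = 0 ∨ (1 - Q) * (1 - T) = 0)
    (h : P * Q = 0) : P * T = 0 := by
  refine hPT'.resolve_right fun h1 => ?_
  have h2 : Q * T = Q := by
    have : Q * ((1 - P) * (1 - T)) = Q - Q * T - Q * P + Q * P * T := by noncomm_ring
    rw [h1, ← hPQ, h] at this
    simp only [mul_zero, sub_zero, zero_mul, add_zero] at this
    exact (sub_eq_zero.1 this.symm).symm
  rcases hQT' with h3 | h3
  · exact hQ0 (h2.symm.trans h3)
  · have : (1 - Q) * (1 - T) = 1 - T - Q + Q * T := by noncomm_ring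
    rw [h3, h2, sub_add_cancel] at this
    exact hT1 (sub_eq_zero.1 this.symm).symm

/-- If one of the pairwise products vanishes, then so do all of them, for nontrivial commuting
idempotents that are pairwise orthogonal or co-orthogonal. -/
lemma pairwise_mul_eq_zero {R ι : Type*} [Ring R] {s : Set ι} {t : ι → R}
    (h0 : ∀ x ∈ s, t x ≠ 0) (h1 : ∀ x ∈ s, t x ≠ 1)
    (hcomm : ∀ x ∈ s, ∀ y ∈ s, t x * t y = t y * t x)
    (hor : ∀ x ∈ s, ∀ y ∈ s, x ≠ y → t x * t y = 0 ∨ (1 - t x) * (1 - t y) = 0)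
    (h : ∃ x ∈ s, ∃ y ∈ s, x ≠ y ∧ t x * t y = 0) :
    ∀ x ∈ s, ∀ y ∈ s, x ≠ y → t x * t y = 0 := by
  have step : ∀ x ∈ s, ∀ y ∈ s, ∀ z ∈ s, x ≠ y → x ≠ z → t x * t y = 0 → t x * t z = 0 := by
    intro x hx y hy z hz hxy hxz hzero
    by_cases hyz : y = z
    · rwa [← hyz]
    · exact mul_eq_zero_of_orthogonal_or (h0 y hy) (h1 z hz) (hcomm x hx y hy)
        (hor x hx z hz hxz) (hor y hy z hz hyz) hzero
  obtain ⟨x, hx, y, hy, hxy, hzero⟩ := h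
  intro u hu v hv huv
  have hzero' : t y * t x = 0 := by rw [← hcomm x hx y hy, hzero]
  by_cases hux : u = x
  · subst hux
    exact step u hu y hy v hv hxy huv hzero
  · have h2 : t x * t u = 0 := step x hx y hy u hu hxy (Ne.symm hux) hzero
    rw [hcomm x hx u hu] at h2
    exact step u hu x hx v hv hux huv h2

theorem statement11 [IsSimpleRing A] [IsSimpleRing B] (φ : Aˣ ≃* Bˣ)
    (e f g : A) (he : IsIdempotentElem e) (he0 : e ≠ 0) (he1 : e ≠ 1)
    (hf : IsIdempotentElem f) (hf0 : f ≠ 0) (hf1 : f ≠ 1)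
    (hg : IsIdempotentElem g) (hg0 : g ≠ 0) (hg1 : g ≠ 1)
    (hef : e * f = 0) (hfe : f * e = 0) (heg : e * g = 0) (hge : g * e = 0)
    (hfg : f * g = 0) (hgf : g * f = 0) (hone : e + f + g ≠ 1)
    (hcef : cEquiv (⇑φ) e f) (hceg : cEquiv (⇑φ) e g) (hcfg : cEquiv (⇑φ) f g) :
    ((∃ x ∈ ({e, f, g} : Set A), ∃ y ∈ ({e, f, g} : Set A), x ≠ y ∧
        theta (⇑φ) x * theta (⇑φ) y = 0) →
      ∀ x ∈ ({e, f, g} : Set A), ∀ y ∈ ({e, f, g} : Set A), x ≠ y →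
        theta (⇑φ) x * theta (⇑φ) y = 0) ∧
    ((∃ x ∈ ({e, f, g} : Set A), ∃ y ∈ ({e, f, g} : Set A), x ≠ y ∧
        theta (⇑φ) (1 - x) * theta (⇑φ) (1 - y) = 0) →
      ∀ x ∈ ({e, f, g} : Set A), ∀ y ∈ ({e, f, g} : Set A), x ≠ y →
        theta (⇑φ) (1 - x) * theta (⇑φ) (1 - y) = 0) := by
  set s : Set A := {e, f, g} with hs
  have hs_forall : ∀ p : A → Prop, p e → p f → p g → ∀ x ∈ s, p x := by
    rintro p h1 h2 h3 x (rfl | rfl | rfl) <;> assumption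
  have hid : ∀ x ∈ s, IsIdempotentElem x := hs_forall _ he hf hg
  have hne0 : ∀ x ∈ s, x ≠ 0 := hs_forall _ he0 hf0 hg0
  have hne1 : ∀ x ∈ s, x ≠ 1 := hs_forall _ he1 hf1 hg1
  have horth : ∀ x ∈ s, ∀ y ∈ s, x ≠ y → x * y = 0 := by
    rintro x (rfl | rfl | rfl) y (rfl | rfl | rfl) hxy <;> first | assumption | exact (hxy rfl).elim
  have hcomm : ∀ x ∈ s, ∀ y ∈ s, theta φ x * theta φ y = theta φ y * theta φ x := by
    intro x hx y hy
    by_cases hxy : x = y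
    · rw [hxy]
    · exact theta_commute φ (hid x hx) (hid y hy)
        ((horth x hx y hy hxy).trans (horth y hy x hx (Ne.symm hxy)).symm)
  have hsymm : ∀ x y : A, cEquiv φ x y → cEquiv φ y x := by
    rintro x y ⟨a, b, a', b', h, h', hc⟩
    exact ⟨a', b', a, b, h', h, fun l => (hc l).symm⟩
  have hc : ∀ x ∈ s, ∀ y ∈ s, x ≠ y → cEquiv φ x y := by
    rintro x (rfl | rfl | rfl) y (rfl | rfl | rfl) hxy <;>
      first | assumption | exact (hxy rfl).elim | (apply hsymm; assumption)
  have hor : ∀ x ∈ s, ∀ y ∈ s, x ≠ y →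
      theta φ x * theta φ y = 0 ∨ (1 - theta φ x) * (1 - theta φ y) = 0 := fun x hx y hy hxy =>
    theta_mul_eq_zero_or φ (hid x hx) (hne0 x hx) (hne1 x hx) (hid y hy) (horth x hx y hy hxy)
      (horth y hy x hx (Ne.symm hxy)) (hc x hx y hy hxy)
  have hsub : ∀ x ∈ s, theta φ (1 - x) = 1 - theta φ x := fun x hx => theta_one_sub φ (hid x hx)
  constructor
  · exact pairwise_mul_eq_zero (fun x hx => theta_ne_zero φ (hid x hx) (hne0 x hx))
      (fun x hx => theta_ne_one φ (hid x hx) (hne1 x hx)) hcomm hor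
  · refine pairwise_mul_eq_zero (t := fun x => theta φ (1 - x))
      (fun x hx => theta_ne_zero φ (hid x hx).one_sub (sub_ne_zero.2 (hne1 x hx).symm))
      (fun x hx => theta_ne_one φ (hid x hx).one_sub (by simpa using hne0 x hx)) ?_ ?_
    · intro x hx y hy
      simp only [hsub x hx, hsub y hy, mul_sub, sub_mul, one_mul, mul_one, hcomm x hx y hy]
      abel
    · intro x hx y hy hxy
      simpa only [hsub x hx, hsub y hy, sub_sub_cancel] using (hor x hx y hy hxy).symm

end
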